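/- (Halphen's system.) For every τ in the upper half plane ℍ, writing δ = (1/πi)·d/dτ, the logarithmic derivatives of the genus-one thetanulls satisfy δψ_{10}(τ) = 2(ψ_{10}ψ_{00} + ψ_{10}ψ_{01} − ψ_{00}ψ_{01})(τ), δψ_{00}(τ) = 2(ψ_{10}ψ_{00} + ψ_{00}ψ_{01} − ψ_{10}ψ_{01})(τ), and δψ_{01}(τ) = 2(ψ_{10}ψ_{01} + ψ_{00}ψ_{01} − ψ_{10}ψ_{00})(τ). -/

import Mathlib

open Complex BigOperators

noncomputable section

/-- The genus-one thetanull `θ₀₀(τ) = ∑ₙ exp(πi n² τ)`. -/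
def theta00 (τ : ℂ) : ℂ :=
  ∑' n : ℤ, Complex.exp ((Real.pi : ℂ) * Complex.I * (n : ℂ) ^ 2 * τ)

/-- The genus-one thetanull `θ₀₁(τ) = ∑ₙ (−1)ⁿ exp(πi n² τ)`. -/
def theta01 (τ : ℂ) : ℂ :=
  ∑' n : ℤ, (-1 : ℂ) ^ n * Complex.exp ((Real.pi : ℂ) * Complex.I * (n : ℂ) ^ 2 * τ)

/-- The genus-one thetanull `θ₁₀(τ) = ∑ₙ exp(πi (n+1/2)² τ)`. -/
def theta10 (τ : ℂ) : ℂ :=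
  ∑' n : ℤ, Complex.exp ((Real.pi : ℂ) * Complex.I * ((n : ℂ) + 1 / 2) ^ 2 * τ)

/-- The logarithmic derivative `ψ_f = (1/πi) f′/f`. -/
def psiLog (f : ℂ → ℂ) (τ : ℂ) : ℂ :=
  1 / ((Real.pi : ℂ) * Complex.I) * (deriv f τ / f τ)

open Filter Topology Asymptotics
open scoped ModularForm MatrixGroups

/-- The upper half plane as a set. -/
def HH : Set ℂ := {z : ℂ | 0 < z.im}

lemma isOpen_HH : IsOpen HH := isOpen_lt continuous_const Complex.continuous_im

lemma convex_HH : Convex ℝ HH := convex_halfSpace_im_gt 0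

lemma mem_HH {τ : ℂ} : τ ∈ HH ↔ 0 < τ.im := Iff.rfl

/-- The filter `Im τ → ∞`. -/
def Iinf : Filter ℂ := comap Complex.im atTop

lemma eventually_Iinf {p : ℂ → Prop} : (∀ᶠ z in Iinf, p z) ↔ ∃ A : ℝ, ∀ z : ℂ, A ≤ z.im → p z := by
  simp only [Iinf, eventually_comap, eventually_atTop]
  constructor
  · rintro ⟨A, h⟩
    exact ⟨A, fun z hz => h _ hz z rfl⟩
  · rintro ⟨A, h⟩
    exact ⟨A, fun b hb z hz => h z (hz ▸ hb)⟩

lemma eventually_HH : ∀ᶠ z in Iinf, z ∈ HH :=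
  eventually_Iinf.2 ⟨1, fun z hz => by rw [mem_HH]; linarith⟩

lemma tendsto_deriv_Iinf {f : ℂ → ℂ} {c : ℂ} (hd : DifferentiableOn ℂ f HH)
    (hf : Tendsto f Iinf (𝓝 c)) : Tendsto (deriv f) Iinf (𝓝 0) := by
  rw [Metric.tendsto_nhds] at hf ⊢
  intro ε hε
  obtain ⟨A, hA⟩ := eventually_Iinf.1 (hf (ε / 2) (by positivity))
  refine eventually_Iinf.2 ⟨max A 0 + 2, fun z hz => ?_⟩
  have him : ∀ w ∈ Metric.closedBall z 1, max A 0 + 1 ≤ w.im := by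
    intro w hw
    rw [Metric.mem_closedBall, dist_eq_norm] at hw
    have := (Complex.abs_im_le_norm (w - z)).trans hw
    rw [Complex.sub_im, abs_le] at this
    linarith [this.1]
  have key := Complex.norm_deriv_le_of_forall_mem_sphere_norm_le (c := z) (R := 1) (C := ε / 2)
    (f := fun w => f w - c) one_pos ?_ ?_
  · rw [deriv_sub_const] at key
    rw [dist_zero_right]
    linarith
  · refine DifferentiableOn.diffContOnCl_ball (U := HH) (hd.sub_const c) fun w hw => ?_
    have := him w hw
    rw [mem_HH]
    linarith [le_max_right A 0]
  · intro w hw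
    have h1 := him w (Metric.sphere_subset_closedBall hw)
    have := hA w (by linarith [le_max_left A 0])
    rw [dist_eq_norm] at this
    exact this.le

lemma cusp12 (f : ℂ → ℂ) (hd : DifferentiableOn ℂ f HH)
    (hT : ∀ τ ∈ HH, f (τ + 1) = f τ) (hS : ∀ τ ∈ HH, f (-1 / τ) = τ ^ 12 * f τ)
    (h0 : Tendsto f Iinf (𝓝 0)) :
    ∃ c : ℂ, ∀ τ : UpperHalfPlane, f τ = c * ModularForm.discriminant τ := by
  have hS' : ((fun z : UpperHalfPlane => f z) ∣[(12 : ℤ)] ModularGroup.S) =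
      (fun z : UpperHalfPlane => f z) := by
    ext z
    rw [ModularForm.SL_slash_apply, UpperHalfPlane.modular_S_smul]
    have := hS z z.2
    have hz : (z : ℂ) ≠ 0 := UpperHalfPlane.ne_zero z
    rw [neg_div, one_div] at this
    rw [ModularGroup.denom_S]
    simp only [UpperHalfPlane.coe_mk, inv_neg, this]
    rw [zpow_neg]
    norm_cast
    field_simp
  have hT' : ((fun z : UpperHalfPlane => f z) ∣[(12 : ℤ)] ModularGroup.T) =
      (fun z : UpperHalfPlane => f z) := by
    ext z
    have hden : UpperHalfPlane.denom ModularGroup.T z = 1 := by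
      rw [ModularGroup.denom_apply]
      simp [ModularGroup.coe_T]
    rw [ModularForm.SL_slash_apply, hden, UpperHalfPlane.modular_T_smul]
    have := hT z z.2
    simp [add_comm (1 : ℂ), this]
  have h0' : UpperHalfPlane.IsZeroAtImInfty (fun z : UpperHalfPlane => f z) :=
    h0.comp UpperHalfPlane.tendsto_coe_atImInfty
  let F : CuspForm 𝒮ℒ 12 :=
    { toFun := fun z => f z
      slash_action_eq' := by
        rintro A ⟨A, rfl⟩
        exact SlashInvariantForm.slash_action_generators_SL2Z hS' hT' A
      holo' := by
        rw [UpperHalfPlane.mdifferentiable_iff]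
        refine DifferentiableOn.congr hd fun z hz => ?_
        simp [UpperHalfPlane.ofComplex_apply_of_im_pos hz]
      zero_at_cusps' := by
        intro c hc
        rw [Subgroup.IsArithmetic.isCusp_iff_isCusp_SL2Z] at hc
        rw [OnePoint.isZeroAt_iff_forall_SL2Z hc]
        intro γ _
        rw [SlashInvariantForm.slash_action_generators_SL2Z hS' hT']
        exact h0' }
  obtain ⟨c, hc⟩ := CuspForm.exists_smul_discriminant_of_weight_eq_twelve F
  refine ⟨c, fun τ => ?_⟩
  have := DFunLike.congr_fun hc τ
  exact this.symm

/-! ### Thetanulls -/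

/-- `θ₁₀` without its fractional power of `q`. -/
def thetaG (τ : ℂ) : ℂ := jacobiTheta₂ (τ / 2) τ

lemma theta00_eq (τ : ℂ) : theta00 τ = jacobiTheta₂ 0 τ := by
  simp [theta00, jacobiTheta₂, jacobiTheta₂_term]

lemma theta00_eq' : theta00 = jacobiTheta := rfl

lemma exp_pi_int (n : ℤ) : cexp (Real.pi * I * n) = (-1) ^ n := by
  rw [mul_comm, Complex.exp_int_mul, Complex.exp_pi_mul_I]

lemma theta01_eq (τ : ℂ) : theta01 τ = jacobiTheta₂ (1 / 2) τ := by
  unfold theta01 jacobiTheta₂ jacobiTheta₂_term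
  refine tsum_congr fun n => ?_
  rw [Complex.exp_add, ← exp_pi_int]
  congr 2
  ring

lemma theta10_eq (τ : ℂ) : theta10 τ = cexp (Real.pi * I / 4 * τ) * thetaG τ := by
  unfold theta10 thetaG jacobiTheta₂ jacobiTheta₂_term
  rw [← tsum_mul_left]
  refine tsum_congr fun n => ?_
  rw [← Complex.exp_add]
  congr 1
  ring

lemma theta00_add_one (τ : ℂ) : theta00 (τ + 1) = theta01 τ := by
  unfold theta00 theta01
  refine tsum_congr fun n => ?_
  have : ((-1 : ℂ)) ^ n = cexp (Real.pi * I * (n : ℂ) ^ 2) := by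
    have h := exp_pi_int (n ^ 2)
    push_cast at h
    rw [h, pow_two, zpow_mul]
    rcases Int.even_or_odd n with hn | hn
    · rw [hn.neg_one_zpow, one_zpow]
    · rw [hn.neg_one_zpow, hn.neg_one_zpow]
  rw [this, ← Complex.exp_add]
  congr 1
  ring

lemma theta00_add_two (τ : ℂ) : theta00 (τ + 2) = theta00 τ := by
  rw [theta00_eq, theta00_eq, jacobiTheta₂_add_right]

lemma theta01_add_one (τ : ℂ) : theta01 (τ + 1) = theta00 τ := by
  rw [← theta00_add_one, ← theta00_add_two τ]
  congr 1
  ring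

lemma theta10_add_one (τ : ℂ) : theta10 (τ + 1) = cexp (Real.pi * I / 4) * theta10 τ := by
  unfold theta10
  rw [← tsum_mul_left]
  refine tsum_congr fun n => ?_
  obtain ⟨k, hk⟩ := Int.even_mul_succ_self n
  have hk' : (n : ℂ) * (n + 1) = k + k := by exact_mod_cast hk
  rw [← Complex.exp_add, Complex.exp_eq_exp_iff_exists_int]
  refine ⟨k, ?_⟩
  linear_combination Real.pi * I * hk'

/-- The automorphy factor. -/
def wfac (τ : ℂ) : ℂ := (-I * τ) ^ (1 / 2 : ℂ)

lemma ne_zero_of_HH {τ : ℂ} (hτ : τ ∈ HH) : τ ≠ 0 := by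
  rintro rfl
  simp [mem_HH] at hτ

lemma wfac_ne {τ : ℂ} (hτ : τ ∈ HH) : wfac τ ≠ 0 := by
  have := ne_zero_of_HH hτ
  simp [wfac, Complex.cpow_eq_zero_iff, this]

lemma wfac_sq (τ : ℂ) : wfac τ ^ 2 = -I * τ := by
  unfold wfac
  rw [← Complex.cpow_nat_mul]
  simp

lemma S_mem {τ : ℂ} (hτ : τ ∈ HH) : -1 / τ ∈ HH := by
  have := UpperHalfPlane.im_inv_neg_coe_pos ⟨τ, hτ⟩
  rw [mem_HH]
  simpa [neg_div, inv_neg] using this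

lemma theta00_S (τ : ℂ) : theta00 τ = (wfac τ)⁻¹ * theta00 (-1 / τ) := by
  rw [theta00_eq, theta00_eq, jacobiTheta₂_functional_equation]
  simp [wfac]

lemma theta01_S {τ : ℂ} (hτ : τ ∈ HH) : theta01 τ = (wfac τ)⁻¹ * theta10 (-1 / τ) := by
  have h := ne_zero_of_HH hτ
  rw [theta01_eq, theta10_eq, thetaG, jacobiTheta₂_functional_equation, ← jacobiTheta₂_neg_left,
    mul_assoc, wfac, one_div]
  congr 3
  · field_simp
    norm_num
  · field_simp

lemma theta10_S {τ : ℂ} (hτ : τ ∈ HH) :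
    ∃ w : ℂ, w ^ 2 = I / τ ∧ theta10 τ = w * theta01 (-1 / τ) := by
  have h := ne_zero_of_HH hτ
  have h2 := theta01_S (S_mem hτ)
  have h1 : -1 / (-1 / τ) = τ := by field_simp
  rw [h1] at h2
  refine ⟨wfac (-1 / τ), ?_, ?_⟩
  · rw [wfac_sq]; field_simp
  · rw [h2, mul_inv_cancel_left₀ (wfac_ne (S_mem hτ))]

lemma diff00 : DifferentiableOn ℂ theta00 HH := fun τ hτ =>
  (differentiableAt_jacobiTheta hτ).differentiableWithinAt

lemma diff01 : DifferentiableOn ℂ theta01 HH := by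
  rw [show theta01 = fun τ => jacobiTheta₂ (1 / 2) τ from funext theta01_eq]
  exact fun τ hτ => (differentiableAt_jacobiTheta₂_snd _ hτ).differentiableWithinAt

lemma diffG : DifferentiableOn ℂ thetaG HH := fun τ hτ => by
  have h := (hasFDerivAt_jacobiTheta₂ (τ / 2) hτ).differentiableAt
  have h2 : DifferentiableAt ℂ (fun t : ℂ => ((t / 2, t) : ℂ × ℂ)) τ := by fun_prop
  exact (DifferentiableAt.comp (f := fun t : ℂ => ((t / 2, t) : ℂ × ℂ))
    (g := fun p : ℂ × ℂ => jacobiTheta₂ p.1 p.2) τ h h2).differentiableWithinAt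

lemma diff10 : DifferentiableOn ℂ theta10 HH := by
  rw [show theta10 = _ from funext theta10_eq]
  exact DifferentiableOn.mul (by fun_prop) diffG

lemma norm_exp_aux (a : ℝ) (τ : ℂ) :
    ‖cexp (Real.pi * I * a * τ)‖ = Real.exp (-(Real.pi * a) * τ.im) := by
  rw [Complex.norm_exp]
  congr 1
  simp

lemma lim_exp {a : ℝ} (ha : 0 < a) :
    Tendsto (fun τ : ℂ => cexp (Real.pi * I * a * τ)) Iinf (𝓝 0) := by
  rw [tendsto_zero_iff_norm_tendsto_zero]
  simp_rw [norm_exp_aux]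
  refine Real.tendsto_exp_atBot.comp ?_
  refine Tendsto.const_mul_atTop_of_neg (by have := Real.pi_pos; nlinarith) tendsto_comap

lemma lim00 : Tendsto theta00 Iinf (𝓝 1) := by
  have h : Tendsto (fun τ => jacobiTheta τ - 1) Iinf (𝓝 0) := by
    refine isBigO_at_im_infty_jacobiTheta_sub_one.trans_tendsto ?_
    refine Real.tendsto_exp_atBot.comp ?_
    exact Tendsto.const_mul_atTop_of_neg (by simpa using Real.pi_pos) tendsto_comap
  have h2 := h.add_const 1
  simp only [sub_add_cancel, zero_add] at h2
  exact h2

lemma lim01 : Tendsto theta01 Iinf (𝓝 1) := by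
  rw [show theta01 = fun τ => theta00 (τ + 1) from funext fun τ => (theta00_add_one τ).symm]
  refine lim00.comp ?_
  rw [Iinf, tendsto_comap_iff]
  simpa [Function.comp_def] using tendsto_comap

lemma limG : Tendsto thetaG Iinf (𝓝 2) := by
  have hterm : ∀ (n : ℤ) (τ : ℂ), jacobiTheta₂_term n (τ / 2) τ =
      cexp (Real.pi * I * ((n * (n + 1) : ℝ)) * τ) := by
    intro n τ
    rw [jacobiTheta₂_term]
    congr 1
    push_cast
    ring
  have hnn : ∀ n : ℤ, (0 : ℝ) ≤ n * (n + 1) := by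
    intro n
    have : 0 ≤ n * (n + 1) := by
      rcases le_or_gt 0 n with h | h
      · positivity
      · nlinarith
    exact_mod_cast this
  have hsum : Summable fun n : ℤ => ‖jacobiTheta₂_term n (I / 2) I‖ :=
    ((summable_jacobiTheta₂_term_iff (I / 2) I).2 (by simp)).norm
  have key := tendsto_tsum_of_dominated_convergence (𝓕 := Iinf)
    (f := fun τ n => jacobiTheta₂_term n (τ / 2) τ)
    (g := fun n : ℤ => if n ∈ ({0, -1} : Finset ℤ) then (1 : ℂ) else 0) hsum ?_ ?_
  · have h2 : (∑' n : ℤ, if n ∈ ({0, -1} : Finset ℤ) then (1 : ℂ) else 0) = 2 := by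
      rw [tsum_eq_sum (s := {0, -1}) (fun n hn => if_neg hn),
        Finset.sum_pair (by norm_num)]
      norm_num
    rw [h2] at key
    exact key
  · intro n
    simp_rw [hterm]
    split_ifs with h
    · have : (n * (n + 1) : ℝ) = 0 := by
        simp only [Finset.mem_insert, Finset.mem_singleton] at h
        rcases h with rfl | rfl <;> simp
      simp only [this, Complex.ofReal_zero, mul_zero, zero_mul, Complex.exp_zero]
      exact tendsto_const_nhds
    · refine lim_exp (lt_of_le_of_ne (hnn n) fun h0 => h ?_)
      have h0' : n * (n + 1) = 0 := by exact_mod_cast h0.symm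
      rcases mul_eq_zero.1 h0' with h1 | h1
      · simp [h1]
      · have : n = -1 := by omega
        simp [this]
  · refine eventually_Iinf.2 ⟨1, fun τ hτ n => ?_⟩
    rw [hterm, hterm, norm_exp_aux, norm_exp_aux, Real.exp_le_exp, Complex.I_im]
    have := mul_nonneg Real.pi_pos.le (hnn n)
    nlinarith

lemma lim10 : Tendsto theta10 Iinf (𝓝 0) := by
  have h := (lim_exp (a := 1 / 4) (by norm_num)).mul limG
  rw [zero_mul] at h
  refine h.congr fun τ => ?_
  rw [theta10_eq]
  congr 2
  push_cast
  ring

/-! ### Nonvanishing -/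

lemma Iinf_neBot : Iinf.NeBot := by
  rw [Iinf, comap_neBot_iff_frequently]
  exact (Eventually.of_forall fun y : ℝ => ⟨y * I, by simp⟩).frequently

lemma prod_ne {τ : ℂ} (hτ : τ ∈ HH) : theta00 τ * theta01 τ * theta10 τ ≠ 0 := by
  have hex : ∃ c : ℂ, ∀ τ : UpperHalfPlane,
      (theta00 τ * theta01 τ * theta10 τ) ^ 8 = c * ModularForm.discriminant τ := by
    refine cusp12 (fun τ => (theta00 τ * theta01 τ * theta10 τ) ^ 8)
      (((diff00.mul diff01).mul diff10).pow 8) ?_ ?_ ?_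
    · intro τ _
      rw [theta00_add_one, theta01_add_one, theta10_add_one]
      have : cexp (Real.pi * I / 4) ^ 8 = 1 := by
        rw [← Complex.exp_nat_mul, ← Complex.exp_two_pi_mul_I]
        congr 1
        push_cast
        ring
      linear_combination (theta01 τ * theta00 τ * theta10 τ) ^ 8 * this
    · intro τ hτ
      have h0 := ne_zero_of_HH hτ
      obtain ⟨w, hw, h10⟩ := theta10_S hτ
      have hw0 := wfac_ne hτ
      have hww := wfac_sq τ
      have a1 : (wfac τ)⁻¹ ^ 16 * w ^ 8 * τ ^ 12 = 1 := by
        rw [show w ^ 8 = (w ^ 2) ^ 4 by ring, hw, inv_pow,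
          show wfac τ ^ 16 = (wfac τ ^ 2) ^ 8 by ring, hww]
        have : (I : ℂ) ^ 4 = 1 := I_pow_four
        have hI : (I : ℂ) ≠ 0 := I_ne_zero
        field_simp
        linear_combination (-1) * this
      rw [theta00_S τ, theta01_S hτ, h10]
      linear_combination (-(theta00 (-1 / τ) * theta10 (-1 / τ) * theta01 (-1 / τ)) ^ 8) * a1
    · have := ((lim00.mul lim01).mul lim10).pow 8
      simpa using this
  · obtain ⟨c, hc⟩ := hex
    have hc0 : c ≠ 0 := by
      rintro rfl
      have e1 := lim00.eventually_ne one_ne_zero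
      have e2 := lim01.eventually_ne one_ne_zero
      have e3 := limG.eventually_ne two_ne_zero
      have := Iinf_neBot
      obtain ⟨z, h1, h2, h3, h4⟩ := (e1.and (e2.and (e3.and eventually_HH))).exists
      have := hc ⟨z, h4⟩
      simp [h1, h2, theta10_eq, h3] at this
    intro h
    have := hc ⟨τ, hτ⟩
    simp only [h] at this
    have h2 := mul_ne_zero hc0 (ModularForm.discriminant_ne_zero ⟨τ, hτ⟩)
    exact h2 (by rw [← this]; norm_num)

lemma ne00 {τ : ℂ} (hτ : τ ∈ HH) : theta00 τ ≠ 0 := fun h => prod_ne hτ (by simp [h])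
lemma ne01 {τ : ℂ} (hτ : τ ∈ HH) : theta01 τ ≠ 0 := fun h => prod_ne hτ (by simp [h])
lemma ne10 {τ : ℂ} (hτ : τ ∈ HH) : theta10 τ ≠ 0 := fun h => prod_ne hτ (by simp [h])
lemma neG {τ : ℂ} (hτ : τ ∈ HH) : thetaG τ ≠ 0 := fun h => ne10 hτ (by simp [theta10_eq, h])

/-! ### Logarithmic derivatives -/

/-- Logarithmic derivative. -/
def LD (f : ℂ → ℂ) (τ : ℂ) : ℂ := deriv f τ / f τ

/-- The defect in Halphen's system. -/
def RR (a b c : ℂ → ℂ) (τ : ℂ) : ℂ :=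
  deriv (LD a) τ - 2 * (LD a τ * LD b τ + LD a τ * LD c τ - LD b τ * LD c τ)

lemma diffLD {f : ℂ → ℂ} (hf : DifferentiableOn ℂ f HH) (h0 : ∀ τ ∈ HH, f τ ≠ 0) :
    DifferentiableOn ℂ (LD f) HH := (hf.deriv isOpen_HH).div hf h0

lemma diffRR {a b c : ℂ → ℂ} (ha : DifferentiableOn ℂ (LD a) HH)
    (hb : DifferentiableOn ℂ (LD b) HH) (hc : DifferentiableOn ℂ (LD c) HH) :
    DifferentiableOn ℂ (RR a b c) HH :=
  (ha.deriv isOpen_HH).sub ((((ha.mul hb).add (ha.mul hc)).sub (hb.mul hc)).const_mul 2)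

lemma limLD {f : ℂ → ℂ} {c : ℂ} (hc : c ≠ 0) (hd : DifferentiableOn ℂ f HH)
    (hf : Tendsto f Iinf (𝓝 c)) : Tendsto (LD f) Iinf (𝓝 0) := by
  have h := (tendsto_deriv_Iinf hd hf).div hf hc
  rw [zero_div] at h
  exact h

lemma d00 : DifferentiableOn ℂ (LD theta00) HH := diffLD diff00 fun _ h => ne00 h
lemma d01 : DifferentiableOn ℂ (LD theta01) HH := diffLD diff01 fun _ h => ne01 h
lemma d10 : DifferentiableOn ℂ (LD theta10) HH := diffLD diff10 fun _ h => ne10 h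

lemma l00 : Tendsto (LD theta00) Iinf (𝓝 0) := limLD one_ne_zero diff00 lim00
lemma l01 : Tendsto (LD theta01) Iinf (𝓝 0) := limLD one_ne_zero diff01 lim01

lemma l10 : Tendsto (LD theta10) Iinf (𝓝 (Real.pi * I / 4)) := by
  have h := (limLD two_ne_zero diffG limG).const_add (Real.pi * I / 4)
  rw [add_zero] at h
  refine h.congr' ?_
  filter_upwards [eventually_HH] with τ hτ
  have hG := neG hτ
  have dG := (diffG.differentiableAt (isOpen_HH.mem_nhds hτ)).hasDerivAt
  have dE : HasDerivAt (fun τ : ℂ => cexp (Real.pi * I / 4 * τ))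
      (cexp (Real.pi * I / 4 * τ) * (Real.pi * I / 4)) τ := by
    simpa using ((hasDerivAt_id τ).const_mul (Real.pi * I / 4 : ℂ)).cexp
  have dd : HasDerivAt theta10 ((cexp (Real.pi * I / 4 * τ) * (Real.pi * I / 4)) * thetaG τ +
      cexp (Real.pi * I / 4 * τ) * deriv thetaG τ) τ := by
    rw [show theta10 = _ from funext theta10_eq]
    exact dE.mul dG
  rw [LD, LD, dd.deriv, theta10_eq]
  have := Complex.exp_ne_zero (Real.pi * I / 4 * τ)
  field_simp

lemma limRR {a b c : ℂ → ℂ} {x y z : ℂ} (ha : DifferentiableOn ℂ (LD a) HH)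
    (hx : Tendsto (LD a) Iinf (𝓝 x)) (hy : Tendsto (LD b) Iinf (𝓝 y))
    (hz : Tendsto (LD c) Iinf (𝓝 z)) (h : x * y + x * z - y * z = 0) :
    Tendsto (RR a b c) Iinf (𝓝 0) := by
  have := (tendsto_deriv_Iinf ha hx).sub
    ((((hx.mul hy).add (hx.mul hz)).sub (hy.mul hz)).const_mul 2)
  rw [h] at this
  simp only [mul_zero, sub_zero] at this
  exact this

lemma LD_T {a b : ℂ → ℂ} {k : ℂ} (hk : k ≠ 0) (h : ∀ τ, a (τ + 1) = k * b τ) (τ : ℂ) :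
    LD a (τ + 1) = LD b τ := by
  rw [LD, LD, ← deriv_comp_add_const, show (fun x => a (x + 1)) = fun x => k * b x from funext h,
    deriv_const_mul_field, h, mul_div_mul_left _ _ hk]

lemma RR_T {a b c a' b' c' : ℂ → ℂ} (ha : ∀ τ, LD a (τ + 1) = LD a' τ)
    (hb : ∀ τ, LD b (τ + 1) = LD b' τ) (hc : ∀ τ, LD c (τ + 1) = LD c' τ) (τ : ℂ) :
    RR a b c (τ + 1) = RR a' b' c' τ := by
  rw [RR, RR, ← deriv_comp_add_const, ha, hb, hc]
  simp_rw [ha]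

lemma t00 (τ : ℂ) : LD theta00 (τ + 1) = LD theta01 τ :=
  LD_T one_ne_zero (fun τ => by rw [theta00_add_one, one_mul]) τ
lemma t01 (τ : ℂ) : LD theta01 (τ + 1) = LD theta00 τ :=
  LD_T one_ne_zero (fun τ => by rw [theta01_add_one, one_mul]) τ
lemma t10 (τ : ℂ) : LD theta10 (τ + 1) = LD theta10 τ :=
  LD_T (Complex.exp_ne_zero _) theta10_add_one τ

lemma hasDerivAt_S {τ : ℂ} (h0 : τ ≠ 0) : HasDerivAt (fun z : ℂ => -1 / z) (1 / τ ^ 2) τ := by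
  have := (hasDerivAt_inv h0).const_mul (-1 : ℂ)
  simpa [div_eq_mul_inv] using this

lemma wfac_deriv {τ : ℂ} (hτ : τ ∈ HH) : HasDerivAt wfac (wfac τ / (2 * τ)) τ := by
  have h0 := ne_zero_of_HH hτ
  have hw := wfac_ne hτ
  have hd : DifferentiableAt ℂ wfac τ := by
    unfold wfac
    refine DifferentiableAt.cpow_const (by fun_prop) ?_
    rw [Complex.mem_slitPlane_iff]
    left
    simpa using mem_HH.1 hτ
  have h1 := hd.hasDerivAt.pow 2
  have h2 : HasDerivAt (wfac ^ 2) (-I) τ := by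
    rw [show wfac ^ 2 = fun τ => -I * τ from funext wfac_sq]
    simpa using (hasDerivAt_id τ).const_mul (-I)
  have h3 := h1.unique h2
  have h4 := wfac_sq τ
  have : deriv wfac τ = wfac τ / (2 * τ) := by
    rw [eq_div_iff (by simp [h0])]
    apply mul_left_cancel₀ hw
    simp at h3
    linear_combination τ * h3 - h4
  rw [← this]
  exact hd.hasDerivAt

lemma LD_S {a b : ℂ → ℂ} (hb : DifferentiableOn ℂ b HH) (hb0 : ∀ τ ∈ HH, b τ ≠ 0)
    (h : ∀ τ ∈ HH, a τ = (wfac τ)⁻¹ * b (-1 / τ)) {τ : ℂ} (hτ : τ ∈ HH) :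
    LD a τ = -1 / (2 * τ) + LD b (-1 / τ) / τ ^ 2 := by
  have h0 := ne_zero_of_HH hτ
  have hw := wfac_ne hτ
  have hS := S_mem hτ
  have hbS := hb0 _ hS
  have db := (hb.differentiableAt (isOpen_HH.mem_nhds hS)).hasDerivAt
  have d1 := db.comp τ (hasDerivAt_S h0)
  have d2 := ((wfac_deriv hτ).inv hw).mul d1
  have d3 : HasDerivAt a _ τ := d2.congr_of_eventuallyEq (by
    filter_upwards [isOpen_HH.mem_nhds hτ] with z hz
    simp [h z hz])
  rw [LD, LD, d3.deriv, h τ hτ]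
  simp only [Function.comp, Pi.inv_apply]
  clear d1 d2 d3 db hS
  generalize deriv b (-1 / τ) = D
  generalize b (-1 / τ) = B at *
  field_simp
  try ring

lemma s00 {τ : ℂ} (hτ : τ ∈ HH) : LD theta00 τ = -1 / (2 * τ) + LD theta00 (-1 / τ) / τ ^ 2 :=
  LD_S diff00 (fun _ h => ne00 h) (fun τ _ => theta00_S τ) hτ
lemma s01 {τ : ℂ} (hτ : τ ∈ HH) : LD theta01 τ = -1 / (2 * τ) + LD theta10 (-1 / τ) / τ ^ 2 :=
  LD_S diff10 (fun _ h => ne10 h) (fun _ h => theta01_S h) hτ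
lemma s10 {τ : ℂ} (hτ : τ ∈ HH) : LD theta10 τ = -1 / (2 * τ) + LD theta01 (-1 / τ) / τ ^ 2 := by
  have h0 := ne_zero_of_HH hτ
  have h := s01 (S_mem hτ)
  have h1 : -1 / (-1 / τ) = τ := by field_simp
  rw [h1] at h
  rw [h]
  field_simp
  ring

lemma RR_S {a b c a' b' c' : ℂ → ℂ} (hd : DifferentiableOn ℂ (LD a') HH)
    (ha : ∀ τ ∈ HH, LD a τ = -1 / (2 * τ) + LD a' (-1 / τ) / τ ^ 2)
    (hb : ∀ τ ∈ HH, LD b τ = -1 / (2 * τ) + LD b' (-1 / τ) / τ ^ 2)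
    (hc : ∀ τ ∈ HH, LD c τ = -1 / (2 * τ) + LD c' (-1 / τ) / τ ^ 2) {τ : ℂ} (hτ : τ ∈ HH) :
    RR a' b' c' (-1 / τ) = τ ^ 4 * RR a b c τ := by
  have h0 := ne_zero_of_HH hτ
  have hS := S_mem hτ
  have da := (hd.differentiableAt (isOpen_HH.mem_nhds hS)).hasDerivAt
  have d1 := da.comp τ (hasDerivAt_S h0)
  have d2 := d1.div ((hasDerivAt_id τ).pow 2) (pow_ne_zero 2 h0)
  have d3 := ((hasDerivAt_S h0).div_const 2).add d2
  have d4 : HasDerivAt (LD a) _ τ := d3.congr_of_eventuallyEq (by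
    filter_upwards [isOpen_HH.mem_nhds hτ] with z hz
    have := ne_zero_of_HH hz
    simp [ha z hz]
    field_simp)
  rw [RR, RR, d4.deriv, ha τ hτ, hb τ hτ, hc τ hτ]
  simp only [Function.comp, Pi.pow_apply, id]
  field_simp
  ring

lemma RR_comm (a b c : ℂ → ℂ) : RR a b c = RR a c b := by
  ext τ
  rw [RR, RR]
  ring

/-- Defect of the first equation. -/
def R10 : ℂ → ℂ := RR theta10 theta00 theta01
/-- Defect of the second equation. -/
def R00 : ℂ → ℂ := RR theta00 theta10 theta01
/-- Defect of the third equation. -/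
def R01 : ℂ → ℂ := RR theta01 theta10 theta00

lemma R10_T (τ : ℂ) : R10 (τ + 1) = R10 τ := by
  rw [R10, RR_T t10 t00 t01, RR_comm]
lemma R00_T (τ : ℂ) : R00 (τ + 1) = R01 τ := RR_T t00 t10 t01 τ
lemma R01_T (τ : ℂ) : R01 (τ + 1) = R00 τ := RR_T t01 t10 t00 τ

lemma R10_S {τ : ℂ} (hτ : τ ∈ HH) : R10 (-1 / τ) = τ ^ 4 * R01 τ := by
  rw [R01, RR_comm]
  exact RR_S d10 (fun _ h => s01 h) (fun _ h => s00 h) (fun _ h => s10 h) hτ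
lemma R01_S {τ : ℂ} (hτ : τ ∈ HH) : R01 (-1 / τ) = τ ^ 4 * R10 τ := by
  rw [R10, RR_comm]
  exact RR_S d01 (fun _ h => s10 h) (fun _ h => s01 h) (fun _ h => s00 h) hτ
lemma R00_S {τ : ℂ} (hτ : τ ∈ HH) : R00 (-1 / τ) = τ ^ 4 * R00 τ := by
  rw [R00, RR_comm]
  nth_rw 2 [RR_comm]
  exact RR_S d00 (fun _ h => s00 h) (fun _ h => s10 h) (fun _ h => s01 h) hτ

lemma R10_d : DifferentiableOn ℂ R10 HH := diffRR d10 d00 d01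
lemma R00_d : DifferentiableOn ℂ R00 HH := diffRR d00 d10 d01
lemma R01_d : DifferentiableOn ℂ R01 HH := diffRR d01 d10 d00

lemma R10_l : Tendsto R10 Iinf (𝓝 0) := limRR d10 l10 l00 l01 (by ring)
lemma R00_l : Tendsto R00 Iinf (𝓝 0) := limRR d00 l00 l10 l01 (by ring)
lemma R01_l : Tendsto R01 Iinf (𝓝 0) := limRR d01 l01 l10 l00 (by ring)

lemma decay {f : ℂ → ℂ} (hd : DifferentiableOn ℂ f HH) (hl : Tendsto f Iinf (𝓝 0))
    (hp : ∀ τ, f (τ + 1 + 1) = f τ) :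
    f =O[Iinf] fun z => Real.exp (-Real.pi * z.im) := by
  have h := Function.Periodic.exp_decay_of_zero_at_inf (h := 2) (f := f) two_pos
    (fun z => by rw [← hp z]; congr 1; push_cast; ring)
    (eventually_HH.mono fun z hz => hd.differentiableAt (isOpen_HH.mem_nhds hz)) hl
  refine h.trans (IsBigO.of_bound 1 (Eventually.of_forall fun z => ?_))
  rw [one_mul]
  apply le_of_eq
  congr 2
  ring

lemma R_prod {τ : ℂ} (hτ : τ ∈ HH) : R10 τ * (R00 τ * R01 τ) = 0 := by
  obtain ⟨c, hc⟩ := cusp12 (fun τ => R10 τ * (R00 τ * R01 τ)) (R10_d.mul (R00_d.mul R01_d))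
    (fun τ _ => by simp only [R10_T, R00_T, R01_T]; ring)
    (fun τ hτ => by simp only [R10_S hτ, R00_S hτ, R01_S hτ]; ring)
    (by simpa using R10_l.mul (R00_l.mul R01_l))
  suffices c = 0 by
    have := hc ⟨τ, hτ⟩
    simp_all
  have b := (decay R10_d R10_l fun τ => by rw [R10_T, R10_T]).mul
    ((decay R00_d R00_l fun τ => by rw [R00_T, R01_T]).mul
      (decay R01_d R01_l fun τ => by rw [R01_T, R00_T]))
  have b1 := b.comp_tendsto UpperHalfPlane.tendsto_coe_atImInfty
  have b2 : (fun z : UpperHalfPlane => c * ModularForm.discriminant z) =O[UpperHalfPlane.atImInfty]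
      fun z : UpperHalfPlane => Real.exp (-3 * Real.pi * z.im) := by
    refine b1.congr (fun z => hc z) fun z => ?_
    simp only [Function.comp, UpperHalfPlane.coe_im]
    rw [← Real.exp_add, ← Real.exp_add]
    congr 1
    ring
  have b4 : (fun z : UpperHalfPlane => c * (Real.exp (-2 * Real.pi * z.im) : ℂ))
      =O[UpperHalfPlane.atImInfty] fun z : UpperHalfPlane => c * ModularForm.discriminant z := by
    refine (isBigO_refl (fun _ => c) _).mul ?_
    refine IsBigO.trans (IsBigO.of_bound 1 (Eventually.of_forall fun z => ?_))
      ModularForm.exp_isBigO_discriminant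
    rw [one_mul, Complex.norm_real]
  have b5 : (fun z : UpperHalfPlane => (Real.exp (2 * Real.pi * z.im) : ℂ))
      =O[UpperHalfPlane.atImInfty] fun z : UpperHalfPlane => Real.exp (2 * Real.pi * z.im) := by
    refine IsBigO.of_bound 1 (Eventually.of_forall fun z => ?_)
    rw [one_mul, Complex.norm_real]
  have b6 : (fun _ : UpperHalfPlane => c) =O[UpperHalfPlane.atImInfty]
      fun z : UpperHalfPlane => Real.exp (-Real.pi * z.im) := by
    refine ((b4.trans b2).mul b5).congr (fun z => ?_) fun z => ?_
    · rw [mul_assoc, ← Complex.ofReal_mul, ← Real.exp_add,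
        show -2 * Real.pi * z.im + 2 * Real.pi * z.im = 0 by ring, Real.exp_zero,
        Complex.ofReal_one, mul_one]
    · rw [← Real.exp_add]
      congr 1
      ring
  have b7 : Tendsto (fun z : UpperHalfPlane => Real.exp (-Real.pi * z.im))
      UpperHalfPlane.atImInfty (𝓝 0) :=
    Real.tendsto_exp_atBot.comp
      (Tendsto.const_mul_atTop_of_neg (by simpa using Real.pi_pos) tendsto_comap)
  exact tendsto_nhds_unique tendsto_const_nhds (b6.trans_tendsto b7)

theorem R_zero : ∀ τ ∈ HH, R10 τ = 0 ∧ R00 τ = 0 ∧ R01 τ = 0 := by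
  have hU := convex_HH.isPreconnected
  have an : ∀ {f : ℂ → ℂ}, DifferentiableOn ℂ f HH → AnalyticOnNhd ℂ f HH :=
    fun h => h.analyticOnNhd isOpen_HH
  have hadd : ∀ {τ}, τ ∈ HH → τ + 1 ∈ HH := fun {τ} h => by
    rw [mem_HH] at h ⊢
    simpa using h
  -- vanishing of each defect propagates to the others
  have p1 : (∀ τ ∈ HH, R01 τ = 0) → ∀ τ ∈ HH, R00 τ = 0 := fun h τ hτ => by
    rw [← R01_T]; exact h _ (hadd hτ)
  have p2 : (∀ τ ∈ HH, R00 τ = 0) → ∀ τ ∈ HH, R01 τ = 0 := fun h τ hτ => by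
    rw [← R00_T]; exact h _ (hadd hτ)
  have p3 : (∀ τ ∈ HH, R01 τ = 0) → ∀ τ ∈ HH, R10 τ = 0 := fun h τ hτ => by
    have := R01_S hτ
    rw [h _ (S_mem hτ)] at this
    simpa [ne_zero_of_HH hτ] using this.symm
  have p4 : (∀ τ ∈ HH, R10 τ = 0) → ∀ τ ∈ HH, R01 τ = 0 := fun h τ hτ => by
    have := R10_S hτ
    rw [h _ (S_mem hτ)] at this
    simpa [ne_zero_of_HH hτ] using this.symm
  have h01 : ∀ τ ∈ HH, R01 τ = 0 := by
    rcases AnalyticOnNhd.eq_zero_or_eq_zero_of_mul_eq_zero (an R10_d) (an (R00_d.mul R01_d))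
      (fun z hz => R_prod hz) hU with h | h
    · exact p4 h
    · rcases AnalyticOnNhd.eq_zero_or_eq_zero_of_mul_eq_zero (an R00_d) (an R01_d) h hU with h | h
      · exact p2 h
      · exact h
  exact fun τ hτ => ⟨p3 h01 τ hτ, p1 h01 τ hτ, h01 τ hτ⟩

lemma psiLog_eq (f : ℂ → ℂ) : psiLog f = fun τ => 1 / ((Real.pi : ℂ) * I) * LD f τ := rfl

lemma halphen_of_RR {a b c : ℂ → ℂ} {τ : ℂ} (h : RR a b c τ = 0) :
    1 / ((Real.pi : ℂ) * I) * deriv (psiLog a) τ =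
      2 * (psiLog a τ * psiLog b τ + psiLog a τ * psiLog c τ - psiLog b τ * psiLog c τ) := by
  rw [psiLog_eq, psiLog_eq, psiLog_eq, deriv_const_mul_field]
  rw [RR] at h
  linear_combination (1 / ((Real.pi : ℂ) * I)) ^ 2 * h

/-- Halphen's system for the logarithmic derivatives of the
genus-one thetanulls, with `δ = (1/πi) d/dτ`. -/
theorem halphen_system (τ : ℂ) (hτ : 0 < τ.im) :
    1 / ((Real.pi : ℂ) * Complex.I) * deriv (psiLog theta10) τ =
      2 * (psiLog theta10 τ * psiLog theta00 τ + psiLog theta10 τ * psiLog theta01 τ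
        - psiLog theta00 τ * psiLog theta01 τ) ∧
    1 / ((Real.pi : ℂ) * Complex.I) * deriv (psiLog theta00) τ =
      2 * (psiLog theta10 τ * psiLog theta00 τ + psiLog theta00 τ * psiLog theta01 τ
        - psiLog theta10 τ * psiLog theta01 τ) ∧
    1 / ((Real.pi : ℂ) * Complex.I) * deriv (psiLog theta01) τ =
      2 * (psiLog theta10 τ * psiLog theta01 τ + psiLog theta00 τ * psiLog theta01 τ
        - psiLog theta10 τ * psiLog theta00 τ) := by
  obtain ⟨h1, h2, h3⟩ := R_zero τ hτ
  refine ⟨halphen_of_RR h1, ?_, ?_⟩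
  · rw [halphen_of_RR h2]
    ring
  · rw [halphen_of_RR h3]
    ring
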